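/- Let N ≥ 1 be an integer, let X be a real random variable uniformly distributed on the interval [−1/2, 1/2], and define M(s) = ∫_0^s E[|X|·1_{{|X| ≥ 1/t}}] dt. Then inf{ s > 0 : M(1/s) ≤ 1/N } = (1 + 1/N − √(2/N + 1/N²))/2. -/

import Mathlib

open MeasureTheory ProbabilityTheory

section

variable {Ω : Type} [MeasureSpace Ω] {X : Ω → ℝ}

lemma setIntegral_abs_uniform_eq (hXm : Measurable X)
    (hlaw : Measure.map X ℙ = volume.restrict (Set.Icc (-(1 / 2) : ℝ) (1 / 2))) (c : ℝ) :
    ∫ ω in {w : Ω | c ≤ |X w|}, |X ω| ∂ℙ =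
      ∫ x in {x : ℝ | c ≤ |x|} ∩ Set.Icc (-(1 / 2) : ℝ) (1 / 2), |x| := by
  have hs : MeasurableSet {x : ℝ | c ≤ |x|} := measurableSet_le measurable_const (by fun_prop)
  rw [← Measure.restrict_restrict hs, ← hlaw,
    setIntegral_map hs (by fun_prop) hXm.aemeasurable]
  rfl

lemma tail_expectation_of_half_lt (hXm : Measurable X)
    (hlaw : Measure.map X ℙ = volume.restrict (Set.Icc (-(1 / 2) : ℝ) (1 / 2)))
    {c : ℝ} (hc : 1 / 2 < c) : ∫ ω in {w : Ω | c ≤ |X w|}, |X ω| ∂ℙ = 0 := by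
  have h : {x : ℝ | c ≤ |x|} ∩ Set.Icc (-(1 / 2) : ℝ) (1 / 2) = ∅ := by
    ext x
    simp only [Set.mem_inter_iff, Set.mem_ofPred_eq, ← abs_le, Set.mem_Icc, Set.mem_empty_iff_false,
      iff_false, not_and, not_le]
    exact fun h => hc.trans_le h
  rw [setIntegral_abs_uniform_eq hXm hlaw, h, setIntegral_empty]

lemma tail_expectation_of_le_half (hXm : Measurable X)
    (hlaw : Measure.map X ℙ = volume.restrict (Set.Icc (-(1 / 2) : ℝ) (1 / 2)))
    {c : ℝ} (h₀ : 0 < c) (hc : c ≤ 1 / 2) :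
    ∫ ω in {w : Ω | c ≤ |X w|}, |X ω| ∂ℙ = 1 / 4 - c ^ 2 := by
  have h : {x : ℝ | c ≤ |x|} ∩ Set.Icc (-(1 / 2) : ℝ) (1 / 2) =
      Set.Icc (-(1 / 2)) (-c) ∪ Set.Icc c (1 / 2) := by
    ext x
    simp only [Set.mem_inter_iff, Set.mem_ofPred_eq, Set.mem_Icc, Set.mem_union, le_abs]
    grind
  have hd : Disjoint (Set.Icc (-(1 / 2)) (-c)) (Set.Icc c (1 / 2)) := by
    rw [Set.disjoint_left]
    rintro x ⟨_, hx⟩ ⟨hx', _⟩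
    linarith
  have hpos : ∫ x in Set.Icc c (1 / 2), |x| = (1 / 4 - c ^ 2) / 2 := by
    rw [setIntegral_congr_fun (g := fun x => x) measurableSet_Icc
      (fun x hx => abs_of_nonneg (h₀.le.trans hx.1)), integral_Icc_eq_integral_Ioc,
      ← intervalIntegral.integral_of_le hc, integral_id]
    norm_num
  have hneg : ∫ x in Set.Icc (-(1 / 2)) (-c), |x| = (1 / 4 - c ^ 2) / 2 := by
    rw [setIntegral_congr_fun (g := fun x => -x) measurableSet_Icc
      (fun x hx => abs_of_nonpos (by linarith [hx.2])), integral_Icc_eq_integral_Ioc,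
      ← intervalIntegral.integral_of_le (by linarith), intervalIntegral.integral_neg, integral_id]
    ring
  rw [setIntegral_abs_uniform_eq hXm hlaw, h, setIntegral_union hd measurableSet_Icc
    continuous_abs.continuousOn.integrableOn_Icc continuous_abs.continuousOn.integrableOn_Icc,
    hpos, hneg]
  ring

lemma tail_expectation_inv_of_pos_of_le_two (hXm : Measurable X)
    (hlaw : Measure.map X ℙ = volume.restrict (Set.Icc (-(1 / 2) : ℝ) (1 / 2)))
    {t : ℝ} (h₀ : 0 < t) (ht : t ≤ 2) :
    ∫ ω in {w : Ω | 1 / t ≤ |X w|}, |X ω| ∂ℙ = 0 := by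
  rcases ht.lt_or_eq with ht | rfl
  · exact tail_expectation_of_half_lt hXm hlaw (one_div_lt_one_div_of_lt h₀ ht)
  · rw [tail_expectation_of_le_half hXm hlaw (by norm_num) le_rfl]
    norm_num

lemma orlicz_uniform_of_le_two (hXm : Measurable X)
    (hlaw : Measure.map X ℙ = volume.restrict (Set.Icc (-(1 / 2) : ℝ) (1 / 2)))
    {u : ℝ} (h₀ : 0 ≤ u) (hu : u ≤ 2) :
    ∫ t in (0 : ℝ)..u, ∫ ω in {w : Ω | 1 / t ≤ |X w|}, |X ω| ∂ℙ = 0 := by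
  rw [intervalIntegral.integral_of_le h₀]
  exact setIntegral_eq_zero_of_forall_eq_zero fun t ht =>
    tail_expectation_inv_of_pos_of_le_two hXm hlaw ht.1 (ht.2.trans hu)

lemma orlicz_uniform_of_two_le (hXm : Measurable X)
    (hlaw : Measure.map X ℙ = volume.restrict (Set.Icc (-(1 / 2) : ℝ) (1 / 2)))
    {u : ℝ} (hu : 2 ≤ u) :
    ∫ t in (0 : ℝ)..u, ∫ ω in {w : Ω | 1 / t ≤ |X w|}, |X ω| ∂ℙ = u / 4 + 1 / u - 1 := by
  have hcont : ContinuousOn (fun t : ℝ => 1 / 4 - (1 / t) ^ 2) (Set.uIcc 2 u) := by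
    rw [Set.uIcc_of_le hu]
    refine continuousOn_const.sub ((continuousOn_const.div continuousOn_id ?_).pow 2)
    intro t ht
    have := ht.1
    simp only [id]
    linarith
  have heq : Set.EqOn (fun t : ℝ => 1 / 4 - (1 / t) ^ 2)
      (fun t => ∫ ω in {w : Ω | 1 / t ≤ |X w|}, |X ω| ∂ℙ) (Set.uIcc 2 u) := by
    intro t ht
    rw [Set.uIcc_of_le hu] at ht
    have h2 : (0 : ℝ) < t := by linarith [ht.1]
    exact (tail_expectation_of_le_half hXm hlaw (by positivity)
      (one_div_le_one_div_of_le (by norm_num) ht.1)).symm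
  have hz : Set.EqOn (fun _ : ℝ => (0 : ℝ))
      (fun t => ∫ ω in {w : Ω | 1 / t ≤ |X w|}, |X ω| ∂ℙ) (Set.uIoc 0 2) := by
    intro t ht
    rw [Set.uIoc_of_le (by norm_num)] at ht
    exact (tail_expectation_inv_of_pos_of_le_two hXm hlaw ht.1 ht.2).symm
  rw [← intervalIntegral.integral_add_adjacent_intervals
    (intervalIntegrable_const.congr hz)
    (hcont.congr heq.symm).intervalIntegrable,
    orlicz_uniform_of_le_two hXm hlaw (by norm_num) le_rfl, ← intervalIntegral.integral_congr heq,
    intervalIntegral.integral_eq_sub_of_hasDerivAt (f := fun t : ℝ => t / 4 + t⁻¹) _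
      hcont.intervalIntegrable]
  · rw [one_div]
    ring
  · intro t ht
    rw [Set.uIcc_of_le hu] at ht
    have h2 : t ≠ 0 := by linarith [ht.1]
    exact (((hasDerivAt_id t).div_const 4).add (hasDerivAt_inv h2)).congr_deriv (by ring)

end

theorem stmt12 (N : ℕ) (hN : 1 ≤ N)
    (Ω : Type) [MeasureSpace Ω] [IsProbabilityMeasure (ℙ : Measure Ω)]
    (X : Ω → ℝ) (hXm : Measurable X)
    (hlaw : Measure.map X ℙ = volume.restrict (Set.Icc (-(1 / 2) : ℝ) (1 / 2))) :
    sInf {s : ℝ | 0 < s ∧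
        (∫ t in (0 : ℝ)..(1 / s), ∫ ω in {w : Ω | 1 / t ≤ |X w|}, |X ω| ∂ℙ) ≤ 1 / N} =
      (1 + 1 / N - Real.sqrt (2 / N + 1 / (N : ℝ) ^ 2)) / 2 := by
  have hN' : (0 : ℝ) < N := by exact_mod_cast hN
  obtain ⟨a, ha⟩ : ∃ a : ℝ, a = 1 / N := ⟨_, rfl⟩
  have ha0 : 0 < a := by rw [ha]; positivity
  have hrad : 2 / N + 1 / (N : ℝ) ^ 2 = 2 * a + a ^ 2 := by rw [ha]; ring
  rw [hrad, ← ha]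
  obtain ⟨r, hr⟩ : ∃ r, r = Real.sqrt (2 * a + a ^ 2) := ⟨_, rfl⟩
  have hr2 : r ^ 2 = 2 * a + a ^ 2 := by rw [hr, Real.sq_sqrt (by positivity)]
  have hr0 : 0 ≤ r := hr ▸ Real.sqrt_nonneg _
  have har : a < r := by nlinarith
  have hr1 : r < 1 + a := by nlinarith
  rw [← hr]
  have hset : {s : ℝ | 0 < s ∧
      (∫ t in (0 : ℝ)..(1 / s), ∫ ω in {w : Ω | 1 / t ≤ |X w|}, |X ω| ∂ℙ) ≤ a} =
      Set.Ici ((1 + a - r) / 2) := by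
    ext s
    simp only [Set.mem_ofPred_eq, Set.mem_Ici]
    rcases le_or_gt s 0 with hs | hs
    · exact ⟨fun h => absurd h.1 hs.not_gt, fun h => by linarith⟩
    rcases le_or_gt (1 / 2) s with hs2 | hs2
    · have hu : 1 / s ≤ 2 := by rw [div_le_iff₀ hs]; linarith
      rw [orlicz_uniform_of_le_two hXm hlaw (by positivity) hu]
      exact ⟨fun _ => by linarith, fun _ => ⟨hs, ha0.le⟩⟩
    · have hu : 2 ≤ 1 / s := by rw [le_div_iff₀ hs]; linarith
      have hfac : 1 / s / 4 + 1 / (1 / s) - 1 - a =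
          (s - (1 + a - r) / 2) * (s - (1 + a + r) / 2) / s := by
        field_simp
        linear_combination 4 * hr2
      have hneg : s - (1 + a + r) / 2 < 0 := by linarith
      rw [orlicz_uniform_of_two_le hXm hlaw hu, ← sub_nonpos, hfac, div_le_iff₀ hs, zero_mul,
        and_iff_right hs, ← sub_nonneg (b := (1 + a - r) / 2)]
      exact ⟨fun h => by nlinarith, fun h => mul_nonpos_of_nonneg_of_nonpos h hneg.le⟩
  rw [hset, csInf_Ici]
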